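/- arXiv:2207.08219 — 2 statements merged into one kernel-verified Lean document; each statement's English description precedes it below -/
import Mathlib

section
/- Let N ≥ 1, ε > 0, C > 0, c > 0, let w₁,…,w_N ≥ 0 be real numbers and v₁,…,v_N vectors in a real normed vector space, and fix a distinguished index i₀ such that w_{i₀} ≥ c while wᵢ ≤ εC and ‖vᵢ‖ ≤ εC for all i ≠ i₀. Then the self-normalized sum satisfies ‖ (Σᵢ vᵢ) / (Σⱼ wⱼ) − v_{i₀}/w_{i₀} ‖ ≤ (N − 1) ε C / c + (N − 1) ε C ‖v_{i₀}‖ / c². In particular, when vᵢ = ▽_θ wᵢ are the path gradients of the importance weights and all samples but one are degenerate (w, ▽w of order ε), the path-gradient pq-estimator equals ▽_θ w_{i₀}/w_{i₀} up to an error of order ε. -/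
/-- Perturbing numerator and denominator of `a⁻¹ • x` by `u` and `r`. -/
theorem norm_inv_add_smul_add_sub_le {E : Type*} [NormedAddCommGroup E] [NormedSpace ℝ E]
    {a r c δ : ℝ} (hc : 0 < c) (ha : c ≤ a) (hr : 0 ≤ r) (hrδ : r ≤ δ)
    (x u : E) (hu : ‖u‖ ≤ δ) :
    ‖(a + r)⁻¹ • (x + u) - a⁻¹ • x‖ ≤ δ / c + δ * ‖x‖ / c ^ 2 := by
  have ha0 : 0 < a := hc.trans_le ha
  have hs : 0 < a + r := by positivity
  have hδ : 0 ≤ δ := hr.trans hrδ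
  have key : (a + r)⁻¹ • (x + u) - a⁻¹ • x = (a + r)⁻¹ • u - (r / ((a + r) * a)) • x := by
    have h : r / ((a + r) * a) = a⁻¹ - (a + r)⁻¹ := by
      field_simp
      ring
    rw [h]
    module
  rw [key]
  refine (norm_sub_le _ _).trans (add_le_add ?_ ?_)
  · rw [norm_smul, Real.norm_of_nonneg (by positivity), inv_mul_eq_div]
    gcongr
    linarith
  · rw [norm_smul, Real.norm_of_nonneg (by positivity), div_mul_eq_mul_div, pow_two]
    gcongr
    linarith

/-- Under weight degeneracy (all samples but a distinguished one `i₀`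
have weights and weight-gradients of order `ε`, while `w_{i₀} ≥ c`), the self-normalized
sum `(Σᵢ vᵢ)/(Σⱼ wⱼ)` equals `v_{i₀}/w_{i₀}` up to an error of order `ε`:
`‖(Σᵢ vᵢ)/(Σⱼ wⱼ) − v_{i₀}/w_{i₀}‖ ≤ (N−1)εC/c + (N−1)εC‖v_{i₀}‖/c²`. -/
theorem pathPQ_initial_phase_dominated_by_singular_sample
    {E : Type*} [NormedAddCommGroup E] [NormedSpace ℝ E]
    {N : ℕ} (hN : 1 ≤ N)
    {ε C c : ℝ} (hε : 0 < ε) (hC : 0 < C) (hc : 0 < c)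
    (w : Fin N → ℝ) (hw : ∀ i, 0 ≤ w i)
    (v : Fin N → E) (i₀ : Fin N)
    (hwi₀ : c ≤ w i₀)
    (hwsmall : ∀ i, i ≠ i₀ → w i ≤ ε * C)
    (hvsmall : ∀ i, i ≠ i₀ → ‖v i‖ ≤ ε * C) :
    ‖(∑ j, w j)⁻¹ • (∑ i, v i) - (w i₀)⁻¹ • v i₀‖
      ≤ ((N : ℝ) - 1) * ε * C / c + ((N : ℝ) - 1) * ε * C * ‖v i₀‖ / c ^ 2 := by
  have hcard : ((Finset.univ.erase i₀).card : ℝ) = (N : ℝ) - 1 := by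
    rw [Finset.card_erase_of_mem (Finset.mem_univ i₀), Finset.card_univ, Fintype.card_fin,
      Nat.cast_sub hN, Nat.cast_one]
  have hr : ∑ j ∈ Finset.univ.erase i₀, w j ≤ ((N : ℝ) - 1) * ε * C := by
    rw [mul_assoc, ← hcard, ← nsmul_eq_mul]
    exact Finset.sum_le_card_nsmul _ _ _ fun i hi => hwsmall i (Finset.ne_of_mem_erase hi)
  have hu : ‖∑ i ∈ Finset.univ.erase i₀, v i‖ ≤ ((N : ℝ) - 1) * ε * C := by
    rw [mul_assoc, ← hcard, ← nsmul_eq_mul]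
    exact (norm_sum_le _ _).trans <|
      Finset.sum_le_card_nsmul _ _ _ fun i hi => hvsmall i (Finset.ne_of_mem_erase hi)
  rw [← Finset.add_sum_erase _ w (Finset.mem_univ i₀),
    ← Finset.add_sum_erase _ v (Finset.mem_univ i₀)]
  exact norm_inv_add_smul_add_sub_le hc hwi₀ (Finset.sum_nonneg fun i _ => hw i) hr _ _ hu
end

section
/- Let N ≥ 1, ε > 0, C > 0, c > 0, let w₁,…,w_N ≥ 0 be real numbers and v₁,…,v_N vectors in a real normed vector space, and fix a distinguished index i₀ such that w_{i₀} ≥ c while wᵢ ≤ εC and ‖vᵢ‖ ≤ εC for all i ≠ i₀. Then, writing T = Σⱼ wⱼ, the Z-path-gradient combination satisfies ‖ Σᵢ ( 1/T − wᵢ/T² ) vᵢ ‖ ≤ (N − 1) ε C ‖v_{i₀}‖ / c² + (N − 1) ε C / c. In particular, when vᵢ = ▽_θ wᵢ are the path gradients of the importance weights and all samples but one are degenerate, the Z-path-gradient pq-estimator is of order ε and thus provides no order-one gradient signal in the initial training phase. -/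
/-- Under weight degeneracy (all samples but a distinguished one `i₀`
have weights and weight-gradients of order `ε`, while `w_{i₀} ≥ c`), the Z-path-gradient
combination `Σᵢ (1/T − wᵢ/T²) vᵢ` with `T = Σⱼ wⱼ` is of order `ε`:
`‖Σᵢ (1/T − wᵢ/T²) vᵢ‖ ≤ (N−1)εC‖v_{i₀}‖/c² + (N−1)εC/c`, so the Z-path-gradient
pq-estimator provides no order-one gradient signal in the initial training phase. -/
theorem ZPathPQ_initial_phase_vanishing_gradient
    {E : Type*} [NormedAddCommGroup E] [NormedSpace ℝ E]
    {N : ℕ} (hN : 1 ≤ N)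
    {ε C c : ℝ} (hε : 0 < ε) (hC : 0 < C) (hc : 0 < c)
    (w : Fin N → ℝ) (hw : ∀ i, 0 ≤ w i)
    (v : Fin N → E) (i₀ : Fin N)
    (hwi₀ : c ≤ w i₀)
    (hwsmall : ∀ i, i ≠ i₀ → w i ≤ ε * C)
    (hvsmall : ∀ i, i ≠ i₀ → ‖v i‖ ≤ ε * C) :
    ‖∑ i, ((∑ j, w j)⁻¹ - w i / (∑ j, w j) ^ 2) • v i‖
      ≤ ((N : ℝ) - 1) * ε * C * ‖v i₀‖ / c ^ 2 + ((N : ℝ) - 1) * ε * C / c := by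
  set T := ∑ j, w j
  have hcard : ((Finset.univ.erase i₀).card : ℝ) = (N : ℝ) - 1 := by
    rw [Finset.card_erase_of_mem (Finset.mem_univ _), Finset.card_univ, Fintype.card_fin,
      Nat.cast_sub hN, Nat.cast_one]
  have hsplit : T = w i₀ + ∑ j ∈ Finset.univ.erase i₀, w j :=
    (Finset.add_sum_erase _ _ (Finset.mem_univ i₀)).symm
  have hrest : ∑ j ∈ Finset.univ.erase i₀, w j ≤ ((N : ℝ) - 1) * (ε * C) := by
    rw [← hcard, ← nsmul_eq_mul]
    exact Finset.sum_le_card_nsmul _ _ _ fun i hi ↦ hwsmall i (Finset.ne_of_mem_erase hi)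
  have hle (i : Fin N) : w i ≤ T :=
    Finset.single_le_sum (fun j _ ↦ hw j) (Finset.mem_univ i)
  have hcT : c ≤ T := hwi₀.trans (hle i₀)
  have hTpos : 0 < T := hc.trans_le hcT
  have hcoeff (i : Fin N) : T⁻¹ - w i / T ^ 2 = (T - w i) / T ^ 2 := by
    field_simp
  have hcoeff_nonneg (i : Fin N) : 0 ≤ T⁻¹ - w i / T ^ 2 := by
    rw [hcoeff]
    exact div_nonneg (sub_nonneg.2 (hle i)) (sq_nonneg T)
  have hcoeff_le (i : Fin N) : T⁻¹ - w i / T ^ 2 ≤ c⁻¹ :=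
    (sub_le_self _ (div_nonneg (hw i) (sq_nonneg T))).trans (inv_anti₀ hc hcT)
  have hmain : ‖(T⁻¹ - w i₀ / T ^ 2) • v i₀‖ ≤ ((N : ℝ) - 1) * ε * C * ‖v i₀‖ / c ^ 2 := by
    have hrest_nonneg : 0 ≤ ((N : ℝ) - 1) * (ε * C) :=
      (Finset.sum_nonneg fun j _ ↦ hw j).trans hrest
    have h : T⁻¹ - w i₀ / T ^ 2 ≤ ((N : ℝ) - 1) * (ε * C) / c ^ 2 := by
      rw [hcoeff]
      gcongr
      linarith
    rw [norm_smul, Real.norm_of_nonneg (hcoeff_nonneg i₀)]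
    calc (T⁻¹ - w i₀ / T ^ 2) * ‖v i₀‖
        ≤ ((N : ℝ) - 1) * (ε * C) / c ^ 2 * ‖v i₀‖ := by gcongr
      _ = _ := by ring
  have hothers : ‖∑ i ∈ Finset.univ.erase i₀, (T⁻¹ - w i / T ^ 2) • v i‖
      ≤ ((N : ℝ) - 1) * ε * C / c := by
    calc ‖∑ i ∈ Finset.univ.erase i₀, (T⁻¹ - w i / T ^ 2) • v i‖
        ≤ ∑ i ∈ Finset.univ.erase i₀, c⁻¹ * (ε * C) := by
          refine norm_sum_le_of_le _ fun i hi ↦ ?_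
          rw [norm_smul, Real.norm_of_nonneg (hcoeff_nonneg i)]
          exact mul_le_mul (hcoeff_le i) (hvsmall i (Finset.ne_of_mem_erase hi))
            (norm_nonneg _) (inv_nonneg.2 hc.le)
      _ = ((N : ℝ) - 1) * ε * C / c := by
          rw [Finset.sum_const, nsmul_eq_mul, hcard]
          ring
  rw [← Finset.add_sum_erase _ _ (Finset.mem_univ i₀)]
  exact norm_add_le_of_le hmain hothers
end
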